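/- For every finite simple graph G, the limit gn(G) = lim_{s→∞} gn(G,s) exists; that is, there is a real number L such that the sequence s ↦ gn(G,s) (for integers s ≥ 2) converges to L as s tends to infinity. -/

import Mathlib

/-- A guessing strategy on graph `G` with alphabet `A`: each player `v` maps the
values of its neighbours to a guess of its own value. -/
def GuessStrategy {V : Type*} (G : SimpleGraph V) (A : Type*) : Type _ :=
  ∀ v : V, ((G.neighborSet v) → A) → A

/-- An assignment `a : V → A` is winning for the strategy `F` if every player
guesses its own value correctly. -/
def WinningAssignment {V : Type*} {G : SimpleGraph V} {A : Type*}
    (F : GuessStrategy G A) (a : V → A) : Prop :=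
  ∀ v : V, F v (fun u => a u.1) = a v

/-- The number of assignments won by strategy `F` in the game `(G, s)`. -/
noncomputable def winCount {V : Type*} (G : SimpleGraph V) (s : ℕ)
    (F : GuessStrategy G (Fin s)) : ℕ :=
  Nat.card {a : V → Fin s // WinningAssignment F a}

/-- `N(G,s)`: the maximum number of winning assignments over all strategies. -/
noncomputable def maxWinCount {V : Type*} (G : SimpleGraph V) (s : ℕ) : ℕ :=
  sSup {n | ∃ F : GuessStrategy G (Fin s), winCount G s F = n}

/-- The guessing number `gn(G,s) = log_s N(G,s)`. -/
noncomputable def gn {V : Type*} (G : SimpleGraph V) (s : ℕ) : ℝ :=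
  Real.logb s (maxWinCount G s)

/-- The `t`-uniform blowup of `G`. -/
def blowup {V : Type*} (G : SimpleGraph V) (t : ℕ) : SimpleGraph (V × Fin t) :=
  G.comap Prod.fst

section MaxWinCount

variable {V : Type*}

theorem winCount_le [Fintype V] (G : SimpleGraph V) (s : ℕ) (F : GuessStrategy G (Fin s)) :
    winCount G s F ≤ s ^ Fintype.card V := by
  classical
  calc winCount G s F ≤ Nat.card (V → Fin s) := Finite.card_subtype_le _
    _ = s ^ Fintype.card V := by simp

theorem bddAbove_winCount [Fintype V] (G : SimpleGraph V) (s : ℕ) :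
    BddAbove {n | ∃ F : GuessStrategy G (Fin s), winCount G s F = n} := by
  refine ⟨s ^ Fintype.card V, ?_⟩
  rintro _ ⟨F, rfl⟩
  exact winCount_le G s F

theorem winCount_le_maxWinCount [Fintype V] (G : SimpleGraph V) (s : ℕ)
    (F : GuessStrategy G (Fin s)) : winCount G s F ≤ maxWinCount G s :=
  le_csSup (bddAbove_winCount G s) ⟨F, rfl⟩

theorem exists_winCount_eq_maxWinCount [Fintype V] (G : SimpleGraph V) {s : ℕ} (hs : 1 ≤ s) :
    ∃ F : GuessStrategy G (Fin s), winCount G s F = maxWinCount G s :=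
  have : Nonempty (GuessStrategy G (Fin s)) := ⟨fun _ _ => ⟨0, hs⟩⟩
  Nat.sSup_mem (Set.range_nonempty (winCount G s)) (bddAbove_winCount G s)

theorem maxWinCount_le [Fintype V] (G : SimpleGraph V) (s : ℕ) :
    maxWinCount G s ≤ s ^ Fintype.card V := by
  refine csSup_le' ?_
  rintro _ ⟨F, rfl⟩
  exact winCount_le G s F

theorem one_le_maxWinCount [Fintype V] (G : SimpleGraph V) {s : ℕ} (hs : 1 ≤ s) :
    1 ≤ maxWinCount G s := by
  refine le_trans ?_ (winCount_le_maxWinCount G s fun _ _ => ⟨0, hs⟩)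
  exact Nat.card_pos_iff.2 ⟨⟨⟨fun _ => ⟨0, hs⟩, fun _ => rfl⟩⟩, inferInstance⟩

/-- A strategy over any alphabet that embeds in `Fin s` wins at most `N(G,s)` assignments. -/
theorem card_winningAssignment_le_maxWinCount [Fintype V] (G : SimpleGraph V) {A : Type*}
    [Nonempty A] {s : ℕ} (e : A ↪ Fin s) (F : GuessStrategy G A) :
    Nat.card {a : V → A // WinningAssignment F a} ≤ maxWinCount G s := by
  refine le_trans ?_ (winCount_le_maxWinCount G s
    fun v x => e (F v fun u => Function.invFun e (x u)))
  refine Nat.card_le_card_of_injective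
    (fun a => ⟨fun v => e (a.1 v), fun v => ?_⟩) fun a b hab => ?_
  · simp only [Function.leftInverse_invFun e.injective _]
    rw [a.2 v]
  · ext v
    exact e.injective (congrFun (congrArg Subtype.val hab) v)

/-- Playing two strategies side by side on a product alphabet multiplies the winning counts. -/
theorem maxWinCount_mul_le [Fintype V] (G : SimpleGraph V) {s t u : ℕ} (hs : 1 ≤ s) (ht : 1 ≤ t)
    (h : s * t ≤ u) : maxWinCount G s * maxWinCount G t ≤ maxWinCount G u := by
  obtain ⟨F, hF⟩ := exists_winCount_eq_maxWinCount G hs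
  obtain ⟨F', hF'⟩ := exists_winCount_eq_maxWinCount G ht
  have : Nonempty (Fin s × Fin t) := ⟨(⟨0, hs⟩, ⟨0, ht⟩)⟩
  rw [← hF, ← hF', winCount, winCount, ← Nat.card_prod]
  refine le_trans ?_ (card_winningAssignment_le_maxWinCount G
    (finProdFinEquiv.toEmbedding.trans (Fin.castLEEmb h))
    fun v x => (F v fun w => (x w).1, F' v fun w => (x w).2))
  refine Nat.card_le_card_of_injective
    (fun p => ⟨fun v => (p.1.1 v, p.2.1 v), fun v => Prod.ext (p.1.2 v) (p.2.2 v)⟩)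
    fun p q hpq => ?_
  have hv := fun v => congrFun (congrArg Subtype.val hpq) v
  exact Prod.ext (Subtype.ext (funext fun v => congrArg Prod.fst (hv v)))
    (Subtype.ext (funext fun v => congrArg Prod.snd (hv v)))

end MaxWinCount

section Supermultiplicative

variable {N : ℕ → ℕ}

theorem pow_le_of_supermultiplicative (one_le : ∀ s, 1 ≤ s → 1 ≤ N s)
    (mul_le : ∀ {s t u : ℕ}, 1 ≤ s → 1 ≤ t → s * t ≤ u → N s * N t ≤ N u)
    {s : ℕ} (hs : 1 ≤ s) (k : ℕ) {u : ℕ} (h : s ^ k ≤ u) : N s ^ k ≤ N u := by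
  induction k generalizing u with
  | zero => simpa using one_le u (by simpa using h)
  | succ k ih =>
    rw [pow_succ] at h ⊢
    exact (Nat.mul_le_mul_right _ (ih le_rfl)).trans (mul_le (Nat.one_le_pow _ _ hs) hs h)

theorem mul_logb_le_logb_of_supermultiplicative (one_le : ∀ s, 1 ≤ s → 1 ≤ N s)
    (mul_le : ∀ {s t u : ℕ}, 1 ≤ s → 1 ≤ t → s * t ≤ u → N s * N t ≤ N u)
    {s u : ℕ} (hs : 2 ≤ s) (hu : 2 ≤ u) :
    (Nat.log s u : ℝ) / (Nat.log s u + 1) * Real.logb s (N s) ≤ Real.logb u (N u) := by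
  set k := Nat.log s u
  have hs' : (0 : ℝ) < Real.log s := Real.log_pos (by exact_mod_cast hs)
  have hu' : (0 : ℝ) < Real.log u := Real.log_pos (by exact_mod_cast hu)
  have hN : (1 : ℝ) ≤ N s := by exact_mod_cast one_le s (by lia)
  have hlow : k * Real.log (N s) ≤ Real.log (N u) := by
    rw [← Real.log_pow]
    refine Real.log_le_log (by positivity) ?_
    exact_mod_cast pow_le_of_supermultiplicative one_le mul_le (by lia : 1 ≤ s) k
      (Nat.pow_log_le_self s (by lia))
  have hupp : Real.log u ≤ (k + 1) * Real.log s := by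
    have : Real.log u ≤ Real.log ((s : ℝ) ^ (k + 1)) := by
      refine Real.log_le_log (by positivity) ?_
      exact_mod_cast (Nat.lt_pow_succ_log_self hs u).le
    simpa using this
  calc (k : ℝ) / (k + 1) * Real.logb s (N s)
      = k * Real.log (N s) / ((k + 1) * Real.log s) := by
        rw [Real.logb, div_mul_div_comm]
    _ ≤ k * Real.log (N s) / Real.log u := by
        have := Real.log_nonneg hN
        gcongr
    _ ≤ Real.logb u (N u) := by
        rw [Real.logb]
        gcongr

/-- A supermultiplicative sequence of polynomial growth has a well-defined exponent, namely the
supremum of `log_s N(s)`. -/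
theorem tendsto_logb_of_supermultiplicative {d : ℕ} (one_le : ∀ s, 1 ≤ s → 1 ≤ N s)
    (le_pow : ∀ s, N s ≤ s ^ d)
    (mul_le : ∀ {s t u : ℕ}, 1 ≤ s → 1 ≤ t → s * t ≤ u → N s * N t ≤ N u) :
    Filter.Tendsto (fun s : ℕ => Real.logb s (N s)) Filter.atTop
      (nhds (sSup ((fun s : ℕ => Real.logb s (N s)) '' Set.Ici 2))) := by
  have hbdd : BddAbove ((fun s : ℕ => Real.logb s (N s)) '' Set.Ici 2) := by
    refine ⟨d, ?_⟩
    rintro _ ⟨s, hs, rfl⟩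
    have hs2 : 2 ≤ s := hs
    have hN : 0 < N s := one_le s (by lia)
    refine (Real.logb_le_iff_le_rpow (by exact_mod_cast hs2) (by exact_mod_cast hN)).2 ?_
    rw [Real.rpow_natCast]
    exact_mod_cast le_pow s
  refine tendsto_order.2 ⟨fun a ha => ?_, fun a ha => ?_⟩
  · obtain ⟨_, ⟨s, hs, rfl⟩, has⟩ := exists_lt_of_lt_csSup (Set.nonempty_Ici.image _) ha
    have hs2 : 2 ≤ s := hs
    have hlim : Filter.Tendsto (fun k : ℕ => (k : ℝ) / (k + 1) * Real.logb s (N s)) Filter.atTop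
        (nhds (Real.logb s (N s))) := by
      simpa using (tendsto_natCast_div_add_atTop (1 : ℝ)).mul_const (Real.logb s (N s))
    obtain ⟨K, hK⟩ := Filter.eventually_atTop.1 (hlim.eventually (lt_mem_nhds has))
    filter_upwards [Filter.eventually_ge_atTop (s ^ K), Filter.eventually_ge_atTop 2] with u hu hu2
    exact (hK _ (Nat.le_log_of_pow_le hs2 hu)).trans_le
      (mul_logb_le_logb_of_supermultiplicative one_le mul_le hs2 hu2)
  · filter_upwards [Filter.eventually_ge_atTop 2] with u hu
    exact (le_csSup hbdd ⟨u, hu, rfl⟩).trans_lt ha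

end Supermultiplicative

/-- For every finite simple graph G, the limit
gn(G) = lim_{s→∞} gn(G,s) exists. -/
theorem gn_tendsto_limit {V : Type*} [Fintype V] (G : SimpleGraph V) :
    ∃ L : ℝ, Filter.Tendsto (fun s : ℕ => gn G s) Filter.atTop (nhds L) := by
  exact ⟨_, tendsto_logb_of_supermultiplicative (fun s hs => one_le_maxWinCount G hs)
    (fun s => maxWinCount_le G s) fun hs ht h => maxWinCount_mul_le G hs ht h⟩
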